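/- Let p be a prime and a ≥ 3 an integer, and suppose there exists a positive integer d with a dividing 1 + p^d. Let d₀ be the least such positive integer. Then a is coprime to p and the multiplicative order of p modulo a equals 2d₀. -/

import Mathlib

theorem natCast_pow_eq_neg_one_iff_dvd (a p d : ℕ) :
    (p : ZMod a) ^ d = -1 ↔ a ∣ 1 + p ^ d := by
  rw [← ZMod.natCast_eq_zero_iff, eq_neg_iff_add_eq_zero, add_comm]
  push_cast
  rfl

/-- If `d` is the least positive exponent with `x ^ d = -1` and `-1 ≠ 1`, then `x` has
order `2 * d`. -/
theorem orderOf_eq_two_mul_of_pow_eq_neg_one {R : Type*} [Ring R] (hR : (-1 : R) ≠ 1) {x : R}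
    {d : ℕ} (hd : 0 < d) (hx : x ^ d = -1) (hmin : ∀ e : ℕ, 0 < e → x ^ e = -1 → d ≤ e) :
    orderOf x = 2 * d := by
  have hpow : x ^ (2 * d) = 1 := by rw [mul_comm, pow_mul, hx, neg_one_sq]
  have hpos : 0 < orderOf x := orderOf_pos_iff.2 (isOfFinOrder_iff_pow_eq_one.2 ⟨_, by lia, hpow⟩)
  have hlt : d < orderOf x := by
    by_contra! hle
    have hsub : x ^ (d - orderOf x) = -1 := by
      rw [← hx, ← Nat.sub_add_cancel hle, pow_add, pow_orderOf_eq_one, mul_one,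
        Nat.add_sub_cancel]
    rcases hle.eq_or_lt with heq | hlt
    · rw [heq, Nat.sub_self, pow_zero] at hsub
      exact hR hsub.symm
    · have := hmin _ (Nat.sub_pos_of_lt hlt) hsub
      lia
  obtain ⟨k, hk⟩ := orderOf_dvd_of_pow_eq_one hpow
  have hk2 : k < 2 := by
    by_contra! h
    have := Nat.mul_le_mul_left (orderOf x) h
    lia
  interval_cases k <;> lia

/-- if `a ≥ 3` divides `1 + p^d` for some `d ≥ 1`, and `d₀` is the
least such, then `a` is coprime to `p` and the order of `p` mod `a` is `2·d₀`. -/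
theorem stmt_13 (p : ℕ) (hp : p.Prime) (a : ℕ) (ha : 3 ≤ a)
    (d₀ : ℕ) (hd₀pos : 0 < d₀) (hd₀dvd : a ∣ 1 + p ^ d₀)
    (hd₀min : ∀ d : ℕ, 0 < d → a ∣ 1 + p ^ d → d₀ ≤ d) :
    Nat.Coprime a p ∧ orderOf (p : ZMod a) = 2 * d₀ := by
  constructor
  · refine ((Nat.Prime.coprime_iff_not_dvd hp).2 fun hpa => hp.one_lt.ne' ?_).symm
    exact Nat.dvd_one.1 ((Nat.dvd_add_left (dvd_pow_self p hd₀pos.ne')).1 (hpa.trans hd₀dvd))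
  · have : Fact (2 < a) := ⟨ha⟩
    exact orderOf_eq_two_mul_of_pow_eq_neg_one ZMod.neg_one_ne_one hd₀pos
      ((natCast_pow_eq_neg_one_iff_dvd a p d₀).2 hd₀dvd)
      fun e he h => hd₀min e he ((natCast_pow_eq_neg_one_iff_dvd a p e).1 h)
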